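/- For all z with 0 < z < 1, (1/2)·sin(2z) > (1 - z²)·artanh(z); equivalently, the function z ↦ artanh(z)/tan(z) is strictly increasing on (0,1). -/

import Mathlib

/-- The inverse hyperbolic tangent, `artanh z = (1/2) log((1+z)/(1-z))`. -/
noncomputable def artanh (z : ℝ) : ℝ :=
  (1 / 2) * Real.log ((1 + z) / (1 - z))

theorem hasDerivAt_artanh {z : ℝ} (h₁ : -1 < z) (h₂ : z < 1) :
    HasDerivAt artanh (1 / (1 - z ^ 2)) z := by
  have ha : 1 + z ≠ 0 := by linarith
  have hb : 1 - z ≠ 0 := by linarith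
  have hc : 1 - z ^ 2 ≠ 0 := by
    rw [show 1 - z ^ 2 = (1 + z) * (1 - z) by ring]
    exact mul_ne_zero ha hb
  have h := ((((hasDerivAt_id z).const_add 1).div ((hasDerivAt_id z).const_sub 1) hb).log
    (div_ne_zero ha hb)).const_mul (1 / 2 : ℝ)
  refine h.congr_deriv ?_
  simp only [id, Pi.div_apply]
  field_simp
  ring

theorem one_sub_sq_mul_artanh_lt {z : ℝ} (hz : z ∈ Set.Ioo (0 : ℝ) 1) :
    (1 - z ^ 2) * artanh z < z - 2 * z ^ 3 / 3 := by
  have hd : ∀ x ∈ Set.Ico (0 : ℝ) 1,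
      HasDerivAt (fun x => (x - 2 * x ^ 3 / 3) / (1 - x ^ 2) - artanh x)
        (2 / 3 * x ^ 4 / (1 - x ^ 2) ^ 2) x := by
    intro x hx
    have hc : 1 - x ^ 2 ≠ 0 := by nlinarith [hx.1, hx.2]
    have h := (((hasDerivAt_id x).sub
      ((((hasDerivAt_id x).pow 3).const_mul 2).div_const 3)).div
      (((hasDerivAt_id x).pow 2).const_sub 1) hc).sub
      (hasDerivAt_artanh (by linarith [hx.1]) hx.2)
    refine h.congr_deriv ?_
    simp only [id, Pi.pow_apply, Pi.sub_apply]
    field_simp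
    norm_num
    ring
  have hmono := strictMonoOn_of_deriv_pos (convex_Ico (0 : ℝ) 1)
    (fun x hx => (hd x hx).continuousAt.continuousWithinAt) (by
      intro x hx
      rw [interior_Ico] at hx
      rw [(hd x ⟨hx.1.le, hx.2⟩).deriv]
      have hc : 0 < 1 - x ^ 2 := by nlinarith [hx.1, hx.2]
      have := hx.1
      positivity)
  have h := hmono ⟨le_rfl, one_pos⟩ ⟨hz.1.le, hz.2⟩ hz.1
  have hc : 0 < 1 - z ^ 2 := by nlinarith [hz.1, hz.2]
  have h0 : artanh 0 = 0 := by simp [artanh]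
  simp only [h0, ne_eq, OfNat.ofNat_ne_zero, not_false_eq_true, zero_pow, mul_zero, zero_div,
    sub_zero, sub_pos] at h
  rwa [lt_div_iff₀ hc, mul_comm] at h

theorem one_sub_sq_mul_artanh_lt_sin {z : ℝ} (hz : z ∈ Set.Ioo (0 : ℝ) 1) :
    (1 - z ^ 2) * artanh z < (1 / 2) * Real.sin (2 * z) := by
  have hs := Real.sin_gt_sub_cube (mul_pos two_pos hz.1)
  linarith [one_sub_sq_mul_artanh_lt hz]

/-- for `0 < z < 1`, `(1/2) sin(2z) > (1 - z²) artanh z`;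
equivalently, `z ↦ artanh z / tan z` is strictly increasing on `(0,1)`. -/
theorem sin_two_mul_gt_and_artanh_div_tan_strictMono :
    (∀ z ∈ Set.Ioo (0 : ℝ) 1,
      (1 / 2) * Real.sin (2 * z) > (1 - z ^ 2) * artanh z) ∧
    StrictMonoOn (fun z => artanh z / Real.tan z) (Set.Ioo (0 : ℝ) 1) := by
  refine ⟨fun z hz => one_sub_sq_mul_artanh_lt_sin hz, ?_⟩
  have hsin : ∀ z ∈ Set.Ioo (0 : ℝ) 1, 0 < Real.sin z := fun z hz =>
    Real.sin_pos_of_pos_of_lt_pi hz.1 (by linarith [hz.2, Real.pi_gt_three])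
  have hd : ∀ z ∈ Set.Ioo (0 : ℝ) 1, HasDerivAt (fun z => artanh z / Real.tan z)
      (((1 / 2) * Real.sin (2 * z) - (1 - z ^ 2) * artanh z) /
        ((1 - z ^ 2) * Real.sin z ^ 2)) z := by
    intro z hz
    have hc : 1 - z ^ 2 ≠ 0 := by nlinarith [hz.1, hz.2]
    have hs := (hsin z hz).ne'
    have hcos : Real.cos z ≠ 0 := (Real.cos_pos_of_mem_Ioo
      ⟨by linarith [hz.1, Real.pi_gt_three], by linarith [hz.2, Real.pi_gt_three]⟩).ne'
    have ht : Real.tan z ≠ 0 := by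
      rw [Real.tan_eq_sin_div_cos]
      exact div_ne_zero hs hcos
    refine ((hasDerivAt_artanh (by linarith [hz.1]) hz.2).div
      (Real.hasDerivAt_tan hcos) ht).congr_deriv ?_
    rw [Real.tan_eq_sin_div_cos, Real.sin_two_mul]
    field_simp
  refine strictMonoOn_of_deriv_pos (convex_Ioo (0 : ℝ) 1)
    (fun z hz => (hd z hz).continuousAt.continuousWithinAt) fun z hz => ?_
  rw [interior_Ioo] at hz
  rw [(hd z hz).deriv]
  have hc : 0 < 1 - z ^ 2 := by nlinarith [hz.1, hz.2]
  exact div_pos (sub_pos.2 (one_sub_sq_mul_artanh_lt_sin hz))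
    (mul_pos hc (pow_pos (hsin z hz) 2))
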